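/- In dimension d = 2 there exists a sequence u_n ∈ C_c^∞(ℝ², [0,1]) such that u_n(x) = 1 for |x| ≤ 1/n, diam(supp u_n) → 0, ∫|∇u_n(x)|² dx → 0, and ∫|x|²|Δu_n(x)|² dx → 0 as n → ∞. -/

import Mathlib

open MeasureTheory Filter

/-- The Laplacian of `f : ℝ² → ℝ`, as the sum of the second partial derivatives. -/
noncomputable def lapl2 (f : EuclideanSpace ℝ (Fin 2) → ℝ)
    (x : EuclideanSpace ℝ (Fin 2)) : ℝ :=
  ∑ i : Fin 2, fderiv ℝ (fun y => fderiv ℝ f y (EuclideanSpace.single i 1)) x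
      (EuclideanSpace.single i 1)

/-- Smooth step on `ℝ`, equal to `1` on `(-∞, 0]` and to `0` on `[1, ∞)`. -/
noncomputable def smoothStep (s : ℝ) : ℝ := 1 - Real.smoothTransition s

lemma contDiff_smoothStep : ContDiff ℝ (⊤ : ℕ∞) smoothStep :=
  contDiff_const.sub Real.smoothTransition.contDiff

lemma smoothStep_of_nonpos {s : ℝ} (hs : s ≤ 0) : smoothStep s = 1 := by
  simp [smoothStep, Real.smoothTransition.zero_of_nonpos hs]

lemma smoothStep_of_one_le {s : ℝ} (hs : 1 ≤ s) : smoothStep s = 0 := by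
  simp [smoothStep, Real.smoothTransition.one_of_one_le hs]

lemma smoothStep_mem_Icc (s : ℝ) : smoothStep s ∈ Set.Icc (0 : ℝ) 1 :=
  ⟨sub_nonneg.2 (Real.smoothTransition.le_one s),
    sub_le_self _ (Real.smoothTransition.nonneg s)⟩

lemma deriv_smoothStep_of_notMem {s : ℝ} (hs : s ∉ Set.Icc (0 : ℝ) 1) :
    deriv smoothStep s = 0 := by
  rcases lt_or_ge s 0 with h | h
  · have : smoothStep =ᶠ[nhds s] fun _ => 1 := by
      filter_upwards [Iio_mem_nhds h] with t ht using smoothStep_of_nonpos (le_of_lt ht)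
    rw [this.deriv_eq, deriv_const]
  · have h1 : 1 < s := by
      by_contra! h1
      exact hs ⟨h, h1⟩
    have : smoothStep =ᶠ[nhds s] fun _ => 0 := by
      filter_upwards [Ioi_mem_nhds h1] with t ht using smoothStep_of_one_le (le_of_lt ht)
    rw [this.deriv_eq, deriv_const]

lemma deriv_deriv_smoothStep_of_notMem {s : ℝ} (hs : s ∉ Set.Icc (0 : ℝ) 1) :
    deriv (deriv smoothStep) s = 0 := by
  have : deriv smoothStep =ᶠ[nhds s] fun _ => 0 := by
    filter_upwards [isClosed_Icc.isOpen_compl.mem_nhds hs] with t ht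
      using deriv_smoothStep_of_notMem ht
  rw [this.deriv_eq, deriv_const]

lemma contDiff_deriv_smoothStep : ContDiff ℝ (⊤ : ℕ∞) (deriv smoothStep) :=
  (contDiff_infty_iff_deriv.1 contDiff_smoothStep).2

/-- A continuous function vanishing outside `[0, 1]` is bounded. -/
lemma exists_abs_le_of_eq_zero_off_Icc {φ : ℝ → ℝ} (hφ : Continuous φ)
    (h : ∀ s ∉ Set.Icc (0 : ℝ) 1, φ s = 0) : ∃ K, ∀ s, |φ s| ≤ K := by
  have hc : HasCompactSupport φ := HasCompactSupport.intro isCompact_Icc h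
  simpa using hc.exists_bound_of_continuous hφ

/-- The radial function `x ↦ g (c log (τ |x|²))` on the plane. -/
noncomputable def logRadial (g : ℝ → ℝ) (τ c : ℝ) (x : EuclideanSpace ℝ (Fin 2)) : ℝ :=
  g (c * Real.log (τ * ‖x‖ ^ 2))

lemma log_mul_norm_sq_nonpos {τ : ℝ} (hτ : 0 < τ) {x : EuclideanSpace ℝ (Fin 2)}
    (hx : τ * ‖x‖ ^ 2 ≤ 1) :
    Real.log (τ * ‖x‖ ^ 2) ≤ 0 :=
  Real.log_nonpos (by positivity) hx

lemma logRadial_eventuallyEq_one {g : ℝ → ℝ} (hg : ∀ s ≤ 0, g s = 1) {τ c : ℝ} (hτ : 0 < τ)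
    (hc : 0 < c) : logRadial g τ c =ᶠ[nhds 0] fun _ => 1 := by
  have h : ∀ᶠ x : EuclideanSpace ℝ (Fin 2) in nhds 0, τ * ‖x‖ ^ 2 < 1 := by
    refine ContinuousAt.eventually_lt (by fun_prop) continuousAt_const ?_
    simp
  filter_upwards [h] with x hx
  exact hg _ (mul_nonpos_of_nonneg_of_nonpos hc.le (log_mul_norm_sq_nonpos hτ hx.le))

lemma contDiff_logRadial {g : ℝ → ℝ} (hgs : ContDiff ℝ (⊤ : ℕ∞) g) (hg : ∀ s ≤ 0, g s = 1)
    {τ c : ℝ} (hτ : 0 < τ) (hc : 0 < c) : ContDiff ℝ (⊤ : ℕ∞) (logRadial g τ c) := by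
  rw [contDiff_iff_contDiffAt]
  intro x
  rcases eq_or_ne x 0 with rfl | hx
  · exact contDiffAt_const.congr_of_eventuallyEq (logRadial_eventuallyEq_one hg hτ hc)
  · have hx' : τ * ‖x‖ ^ 2 ≠ 0 := by positivity
    refine hgs.contDiffAt.comp x (contDiffAt_const.mul (ContDiffAt.log ?_ hx'))
    exact contDiffAt_const.mul (contDiff_norm_sq ℝ).contDiffAt

lemma hasFDerivAt_logRadial {g : ℝ → ℝ} (hgs : Differentiable ℝ g) {τ : ℝ} (hτ : 0 < τ) (c : ℝ)
    {x : EuclideanSpace ℝ (Fin 2)} (hx : x ≠ 0) :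
    HasFDerivAt (logRadial g τ c)
      ((2 * c * deriv g (c * Real.log (τ * ‖x‖ ^ 2)) / ‖x‖ ^ 2) • innerSL ℝ x) x := by
  have hx' : τ * ‖x‖ ^ 2 ≠ 0 := by positivity
  have h1 : HasFDerivAt (fun y : EuclideanSpace ℝ (Fin 2) => ‖y‖ ^ 2) (2 • innerSL ℝ x) x :=
    (hasStrictFDerivAt_norm_sq x).hasFDerivAt
  have h2 := ((h1.const_mul τ).log hx').const_mul c
  have h3 := (hgs (c * Real.log (τ * ‖x‖ ^ 2))).hasDerivAt.comp_hasFDerivAt x h2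
  refine h3.congr_fderiv ?_
  ext v
  have hn : ‖x‖ ≠ 0 := norm_ne_zero_iff.2 hx
  simp
  field_simp

lemma fderiv_logRadial {g : ℝ → ℝ} (hgs : Differentiable ℝ g) (hg : ∀ s ≤ 0, g s = 1) {τ c : ℝ}
    (hτ : 0 < τ) (hc : 0 < c) (x : EuclideanSpace ℝ (Fin 2)) :
    fderiv ℝ (logRadial g τ c) x =
      (2 * c * deriv g (c * Real.log (τ * ‖x‖ ^ 2)) / ‖x‖ ^ 2) • innerSL ℝ x := by
  rcases eq_or_ne x 0 with rfl | hx
  · rw [(logRadial_eventuallyEq_one hg hτ hc).fderiv_eq]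
    simp
  · exact (hasFDerivAt_logRadial hgs hτ c hx).fderiv

lemma norm_fderiv_logRadial_sq {g : ℝ → ℝ} (hgs : Differentiable ℝ g) (hg : ∀ s ≤ 0, g s = 1)
    {τ c : ℝ} (hτ : 0 < τ) (hc : 0 < c) (x : EuclideanSpace ℝ (Fin 2)) :
    ‖fderiv ℝ (logRadial g τ c) x‖ ^ 2 =
      4 * c ^ 2 * (deriv g (c * Real.log (τ * ‖x‖ ^ 2)) ^ 2 * (‖x‖ ^ 2)⁻¹) := by
  rw [fderiv_logRadial hgs hg hτ hc, norm_smul, innerSL_apply_norm, mul_pow, Real.norm_eq_abs,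
    sq_abs]
  rcases eq_or_ne x 0 with rfl | hx
  · simp
  · have hn : ‖x‖ ≠ 0 := norm_ne_zero_iff.2 hx
    field_simp
    ring

lemma lapl2_logRadial {g : ℝ → ℝ} (hgs : Differentiable ℝ g) (hgs' : Differentiable ℝ (deriv g))
    (hg : ∀ s ≤ 0, g s = 1) {τ c : ℝ} (hτ : 0 < τ) (hc : 0 < c)
    {x : EuclideanSpace ℝ (Fin 2)} (hx : x ≠ 0) :
    lapl2 (logRadial g τ c) x =
      4 * c ^ 2 * deriv (deriv g) (c * Real.log (τ * ‖x‖ ^ 2)) * (‖x‖ ^ 2)⁻¹ := by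
  have hn : ‖x‖ ≠ 0 := norm_ne_zero_iff.2 hx
  have hn2 : ‖x‖ ^ 2 ≠ 0 := by positivity
  have h1 : HasFDerivAt (fun y : EuclideanSpace ℝ (Fin 2) => ‖y‖ ^ 2) (2 • innerSL ℝ x) x :=
    (hasStrictFDerivAt_norm_sq x).hasFDerivAt
  have hinv := (hasDerivAt_inv hn2).comp_hasFDerivAt x h1
  have hD := hasFDerivAt_logRadial hgs' hτ c hx
  have hi : ∀ i : Fin 2,
      fderiv ℝ (fun y => fderiv ℝ (logRadial g τ c) y (EuclideanSpace.single i 1)) x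
        (EuclideanSpace.single i 1) =
      2 * c * (2 * c * deriv (deriv g) (c * Real.log (τ * ‖x‖ ^ 2)) * x i ^ 2 / ‖x‖ ^ 4
        + deriv g (c * Real.log (τ * ‖x‖ ^ 2)) * (1 / ‖x‖ ^ 2 - 2 * x i ^ 2 / ‖x‖ ^ 4)) := by
    intro i
    have hfun : (fun y => fderiv ℝ (logRadial g τ c) y (EuclideanSpace.single i 1)) =
        fun y : EuclideanSpace ℝ (Fin 2) =>
          2 * c * (logRadial (deriv g) τ c y * ((‖y‖ ^ 2)⁻¹ * y i)) := by
      ext y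
      rw [fderiv_logRadial hgs hg hτ hc]
      simp [logRadial, EuclideanSpace.inner_single_right]
      ring
    have hpr : HasFDerivAt (fun y : EuclideanSpace ℝ (Fin 2) => y i)
        (EuclideanSpace.proj i : EuclideanSpace ℝ (Fin 2) →L[ℝ] ℝ) x :=
      (EuclideanSpace.proj i : EuclideanSpace ℝ (Fin 2) →L[ℝ] ℝ).hasFDerivAt
    have hall := (hD.mul (hinv.mul hpr)).const_mul (2 * c)
    rw [hfun]
    have := hall.fderiv
    simp only [Function.comp_def, Pi.mul_def] at this
    rw [this]
    simp [logRadial, EuclideanSpace.inner_single_right]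
    field_simp
    ring
  have hsum : ‖x‖ ^ 2 = x 0 ^ 2 + x 1 ^ 2 := by
    simp [EuclideanSpace.norm_sq_eq, Fin.sum_univ_two]
  rw [lapl2, Fin.sum_univ_two, hi, hi]
  have h4 : x 0 ^ 2 = ‖x‖ ^ 2 - x 1 ^ 2 := by rw [hsum]; ring
  rw [h4]
  field_simp
  ring

lemma norm_sq_mul_lapl2_logRadial_sq {g : ℝ → ℝ} (hgs : Differentiable ℝ g)
    (hgs' : Differentiable ℝ (deriv g)) (hg : ∀ s ≤ 0, g s = 1) {τ c : ℝ} (hτ : 0 < τ)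
    (hc : 0 < c) (x : EuclideanSpace ℝ (Fin 2)) :
    ‖x‖ ^ 2 * |lapl2 (logRadial g τ c) x| ^ 2 =
      16 * c ^ 4 * (deriv (deriv g) (c * Real.log (τ * ‖x‖ ^ 2)) ^ 2 * (‖x‖ ^ 2)⁻¹) := by
  rcases eq_or_ne x 0 with rfl | hx
  · simp
  · have hn : ‖x‖ ≠ 0 := norm_ne_zero_iff.2 hx
    rw [sq_abs, lapl2_logRadial hgs hgs' hg hτ hc hx]
    field_simp
    ring

/-- Radial profile `r⁻²` on an annulus, `0` elsewhere. -/
noncomputable def annulusProfile (a b : ℝ) : ℝ → ℝ :=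
  (Set.Icc a b).indicator fun r => (r ^ 2)⁻¹

lemma integrable_annulusProfile_norm {a b : ℝ} (ha : 0 < a) :
    Integrable (fun x : EuclideanSpace ℝ (Fin 2) => annulusProfile a b ‖x‖) := by
  rw [integrable_fun_norm_addHaar volume (f := annulusProfile a b)]
  have h : IntegrableOn (fun r : ℝ => r ^ (Module.finrank ℝ (EuclideanSpace ℝ (Fin 2)) - 1) •
      (r ^ 2)⁻¹) (Set.Icc a b) := by
    refine ContinuousOn.integrableOn_Icc ?_
    refine (continuousOn_id.pow _).smul (ContinuousOn.inv₀ (by fun_prop) ?_)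
    intro r hr
    have : 0 < r := ha.trans_le hr.1
    positivity
  refine (((integrable_indicator_iff measurableSet_Icc).2 h).congr ?_).integrableOn
  filter_upwards with r
  by_cases hr : r ∈ Set.Icc a b <;> simp [annulusProfile, hr]

lemma integral_annulusProfile_norm {a b : ℝ} (ha : 0 < a) (hab : a ≤ b) :
    ∫ x : EuclideanSpace ℝ (Fin 2), annulusProfile a b ‖x‖ =
      2 * volume.real (Metric.ball (0 : EuclideanSpace ℝ (Fin 2)) 1) * Real.log (b / a) := by
  rw [integral_fun_norm_addHaar volume (annulusProfile a b)]
  have h : ∀ r : ℝ, r ^ (Module.finrank ℝ (EuclideanSpace ℝ (Fin 2)) - 1) •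
      annulusProfile a b r = (Set.Icc a b).indicator (fun r => r⁻¹) r := by
    intro r
    by_cases hr : r ∈ Set.Icc a b
    · have : r ≠ 0 := (ha.trans_le hr.1).ne'
      simp [annulusProfile, hr]
      field_simp
    · simp [annulusProfile, hr]
  have hsub : Set.Icc a b ⊆ Set.Ioi 0 := fun r hr => ha.trans_le hr.1
  simp_rw [h]
  rw [setIntegral_indicator measurableSet_Icc, Set.inter_eq_right.2 hsub,
    integral_Icc_eq_integral_Ioc, ← intervalIntegral.integral_of_le hab,
    integral_inv_of_pos ha (ha.trans_le hab)]
  simp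
  ring

/-- Parameters for which `0 ≤ c log (τ r²) ≤ 1` is the annulus `4 / m ≤ r ≤ 4 / √m`. -/
lemma mem_annulus_of_log_mem_Icc {m r : ℝ} (hm : 1 < m) (hr : 0 < r)
    (h : (Real.log m)⁻¹ * Real.log ((m / 4) ^ 2 * r ^ 2) ∈ Set.Icc (0 : ℝ) 1) :
    r ∈ Set.Icc (4 / m) (4 / √m) := by
  have hl : 0 < Real.log m := Real.log_pos hm
  have hm0 : 0 < m := by linarith
  have hp : 0 < (m / 4) ^ 2 * r ^ 2 := by positivity
  obtain ⟨h0, h1⟩ := h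
  have h0' : 0 ≤ Real.log ((m / 4) ^ 2 * r ^ 2) := by
    by_contra! hneg
    exact absurd h0 (not_le.2 (mul_neg_of_pos_of_neg (inv_pos.2 hl) hneg))
  have h1' : Real.log ((m / 4) ^ 2 * r ^ 2) ≤ Real.log m := by
    rw [inv_mul_le_iff₀ hl] at h1
    simpa using h1
  rw [Real.log_nonneg_iff hp, ← mul_pow] at h0'
  rw [Real.log_le_log_iff hp hm0] at h1'
  constructor
  · have := (one_le_sq_iff₀ (by positivity)).1 h0'
    rw [div_le_iff₀ hm0]
    linarith
  · rw [le_div_iff₀ (Real.sqrt_pos.2 hm0)]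
    refine abs_le_of_sq_le_sq' ?_ (by norm_num) |>.2
    rw [mul_pow, Real.sq_sqrt hm0.le]
    have : m * (m * r ^ 2) ≤ m * 16 := by nlinarith
    have := le_of_mul_le_mul_left this hm0
    linarith

/-- Bound for the weighted integral of a bounded function of `log |x|` supported in an annulus. -/
lemma integral_sq_log_mul_inv_norm_sq_le {φ : ℝ → ℝ} {K : ℝ} (hK : ∀ s, |φ s| ≤ K)
    (hφ : ∀ s ∉ Set.Icc (0 : ℝ) 1, φ s = 0) {m : ℝ} (hm : 1 < m) :
    ∫ x : EuclideanSpace ℝ (Fin 2),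
        φ ((Real.log m)⁻¹ * Real.log ((m / 4) ^ 2 * ‖x‖ ^ 2)) ^ 2 * (‖x‖ ^ 2)⁻¹ ≤
      K ^ 2 * volume.real (Metric.ball (0 : EuclideanSpace ℝ (Fin 2)) 1) * Real.log m := by
  have hm0 : 0 < m := by linarith
  have hs : 0 < √m := Real.sqrt_pos.2 hm0
  have ha : 0 < 4 / m := by positivity
  have hsm : √m ≤ m := by
    rw [Real.sqrt_le_left hm0.le]
    nlinarith
  have hab : 4 / m ≤ 4 / √m := by gcongr
  have hlog : Real.log (4 / √m / (4 / m)) = Real.log m / 2 := by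
    rw [← Real.log_sqrt hm0.le]
    congr 1
    field_simp
    rw [Real.sq_sqrt hm0.le]
  calc _ ≤ ∫ x : EuclideanSpace ℝ (Fin 2), K ^ 2 * annulusProfile (4 / m) (4 / √m) ‖x‖ := by
        refine integral_mono_of_nonneg (Eventually.of_forall fun x => by positivity)
          ((integrable_annulusProfile_norm ha).const_mul _) (Eventually.of_forall fun x => ?_)
        have hnn : 0 ≤ annulusProfile (4 / m) (4 / √m) ‖x‖ :=
          Set.indicator_nonneg (fun r _ => by positivity) _
        dsimp only
        rcases eq_or_ne x 0 with rfl | hx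
        · simpa using mul_nonneg (sq_nonneg K) (by simpa using hnn)
        by_cases hmem : (Real.log m)⁻¹ * Real.log ((m / 4) ^ 2 * ‖x‖ ^ 2) ∈ Set.Icc (0 : ℝ) 1
        · have hx' := mem_annulus_of_log_mem_Icc hm (norm_pos_iff.2 hx) hmem
          rw [annulusProfile, Set.indicator_of_mem hx']
          refine mul_le_mul_of_nonneg_right ?_ (by positivity)
          exact sq_le_sq' (abs_le.1 (hK _)).1 (abs_le.1 (hK _)).2
        · rw [hφ _ hmem]
          simpa using mul_nonneg (sq_nonneg K) hnn
    _ = _ := by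
        rw [integral_const_mul, integral_annulusProfile_norm ha hab, hlog]
        ring

lemma tsupport_logRadial_subset {g : ℝ → ℝ} (hg1 : ∀ s, 1 ≤ s → g s = 0) {m : ℝ}
    (hm : 1 < m) :
    tsupport (logRadial g ((m / 4) ^ 2) (Real.log m)⁻¹) ⊆ Metric.closedBall 0 (4 / √m) := by
  have hm0 : 0 < m := by linarith
  have hl : 0 < Real.log m := Real.log_pos hm
  have hs : 0 < √m := Real.sqrt_pos.2 hm0
  refine closure_minimal ?_ Metric.isClosed_closedBall
  intro x hx
  rw [mem_closedBall_zero_iff]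
  by_contra! hlt
  refine hx (hg1 _ ?_)
  rw [div_lt_iff₀ hs] at hlt
  have h16 : 16 < ‖x‖ ^ 2 * m := by
    have := pow_lt_pow_left₀ hlt (by norm_num) two_ne_zero
    rw [mul_pow, Real.sq_sqrt hm0.le] at this
    linarith
  rw [le_inv_mul_iff₀ hl, mul_one]
  refine Real.log_le_log hm0 ?_
  nlinarith

/-- Lemma 5.2, case `d = 2`: there is a sequence `u_n ∈ C_c^∞(ℝ²,[0,1])` with
`u_n = 1` on `{|x| ≤ 1/n}`, `diam(supp u_n) → 0`, `∫|∇u_n|² dx → 0` and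
`∫|x|²|Δu_n|² dx → 0` as `n → ∞`. -/
theorem cutoff_d_eq_two :
    ∃ u : ℕ → EuclideanSpace ℝ (Fin 2) → ℝ,
      (∀ n, ContDiff ℝ (⊤ : ℕ∞) (u n)) ∧
      (∀ n, HasCompactSupport (u n)) ∧
      (∀ n x, u n x ∈ Set.Icc (0:ℝ) 1) ∧
      (∀ n : ℕ, 0 < n → ∀ x : EuclideanSpace ℝ (Fin 2), ‖x‖ ≤ 1 / n → u n x = 1) ∧
      Tendsto (fun n => Metric.diam (tsupport (u n))) atTop (nhds 0) ∧
      Tendsto (fun n => ∫ x, ‖fderiv ℝ (u n) x‖ ^ 2) atTop (nhds 0) ∧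
      Tendsto (fun n => ∫ x, ‖x‖ ^ 2 * |lapl2 (u n) x| ^ 2) atTop (nhds 0) := by
  have hm : ∀ n : ℕ, 1 < (n : ℝ) + 2 := fun n => by
    have : (0 : ℝ) ≤ n := n.cast_nonneg
    linarith
  have hm0 : ∀ n : ℕ, 0 < (n : ℝ) + 2 := fun n => one_pos.trans (hm n)
  have hl : ∀ n : ℕ, 0 < Real.log ((n : ℝ) + 2) := fun n => Real.log_pos (hm n)
  have hτ : ∀ n : ℕ, 0 < (((n : ℝ) + 2) / 4) ^ 2 := fun n => by have := hm0 n; positivity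
  have hc : ∀ n : ℕ, 0 < (Real.log ((n : ℝ) + 2))⁻¹ := fun n => inv_pos.2 (hl n)
  have hm_top : Tendsto (fun n : ℕ => (n : ℝ) + 2) atTop atTop :=
    tendsto_atTop_add_const_right _ _ tendsto_natCast_atTop_atTop
  have hc_lim : Tendsto (fun n : ℕ => (Real.log ((n : ℝ) + 2))⁻¹) atTop (nhds 0) :=
    (Real.tendsto_log_atTop.comp hm_top).inv_tendsto_atTop
  have hg0 : ∀ s ≤ 0, smoothStep s = 1 := fun s => smoothStep_of_nonpos
  have hg1 : ∀ s, 1 ≤ s → smoothStep s = 0 := fun s => smoothStep_of_one_le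
  have hd : Differentiable ℝ smoothStep := contDiff_smoothStep.differentiable (by simp)
  have hd' : Differentiable ℝ (deriv smoothStep) :=
    contDiff_deriv_smoothStep.differentiable (by simp)
  obtain ⟨K₁, hK₁⟩ := exists_abs_le_of_eq_zero_off_Icc contDiff_deriv_smoothStep.continuous
    fun s => deriv_smoothStep_of_notMem
  obtain ⟨K₂, hK₂⟩ := exists_abs_le_of_eq_zero_off_Icc
    (contDiff_infty_iff_deriv.1 contDiff_deriv_smoothStep).2.continuous
    fun s => deriv_deriv_smoothStep_of_notMem
  set V := volume.real (Metric.ball (0 : EuclideanSpace ℝ (Fin 2)) 1)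
  have hsupp := fun n : ℕ => tsupport_logRadial_subset hg1 (hm n)
  refine ⟨fun n => logRadial smoothStep ((((n : ℝ) + 2) / 4) ^ 2) (Real.log ((n : ℝ) + 2))⁻¹,
    fun n => contDiff_logRadial contDiff_smoothStep hg0 (hτ n) (hc n),
    fun n => (isCompact_closedBall _ _).of_isClosed_subset (isClosed_tsupport _) (hsupp n),
    fun n x => smoothStep_mem_Icc _, fun n hn x hx => ?_, ?_, ?_, ?_⟩
  · have hn' : (1 : ℝ) ≤ n := by exact_mod_cast hn
    refine hg0 _ (mul_nonpos_of_nonneg_of_nonpos (hc n).le (log_mul_norm_sq_nonpos (hτ n) ?_))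
    rw [← mul_pow]
    refine pow_le_one₀ (by positivity) ?_
    rw [le_div_iff₀ (by positivity)] at hx
    nlinarith [norm_nonneg x]
  · have hr : Tendsto (fun n : ℕ => 2 * (4 / √((n : ℝ) + 2))) atTop (nhds 0) := by
      simpa using ((Real.tendsto_sqrt_atTop.comp hm_top).const_div_atTop 4).const_mul 2
    refine squeeze_zero (fun n => Metric.diam_nonneg) (fun n => ?_) hr
    exact (Metric.diam_mono (hsupp n) Metric.isBounded_closedBall).trans
      (Metric.diam_closedBall (by positivity))
  · have hr := hc_lim.const_mul (4 * (K₁ ^ 2 * V))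
    rw [mul_zero] at hr
    refine squeeze_zero (fun n => integral_nonneg fun x => by positivity) (fun n => ?_) hr
    simp_rw [norm_fderiv_logRadial_sq hd hg0 (hτ n) (hc n)]
    rw [integral_const_mul]
    refine (mul_le_mul_of_nonneg_left (integral_sq_log_mul_inv_norm_sq_le hK₁
      (fun s => deriv_smoothStep_of_notMem) (hm n)) (by positivity)).trans_eq ?_
    have := (hl n).ne'
    field_simp
    rfl
  · have hr := (hc_lim.pow 3).const_mul (16 * (K₂ ^ 2 * V))
    rw [zero_pow three_ne_zero, mul_zero] at hr
    refine squeeze_zero (fun n => integral_nonneg fun x => by positivity) (fun n => ?_) hr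
    simp_rw [norm_sq_mul_lapl2_logRadial_sq hd hd' hg0 (hτ n) (hc n)]
    rw [integral_const_mul]
    refine (mul_le_mul_of_nonneg_left (integral_sq_log_mul_inv_norm_sq_le hK₂
      (fun s => deriv_deriv_smoothStep_of_notMem) (hm n)) (by positivity)).trans_eq ?_
    have := (hl n).ne'
    field_simp
    rfl
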